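/- Let r be a uniform rigid resource expression (r ¨ r) and b⃗ a rigid monomial with |b⃗| = n_x(r). Then Card(subSt_x(r,b⃗)) = Card(D(r)) · Card(D^!(b⃗)) / Card(D(r[b⃗/x])), where subSt_x(r,b⃗) = {σ ∈ S_{n_x(r)} | r[b⃗/x] ≅ r[σ·b⃗/x]}. -/

import Mathlib

set_option maxHeartbeats 1000000

/-! ### Rigid resource terms -/

/-- Rigid resource terms (de Bruijn indices for variables):
`a ::= x | λ.a | ⟨a⟩b⃗ | a⊕• | •⊕a` where argument lists are ordered. -/
inductive Rt : Type
  | var : ℕ → Rt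
  | lam : Rt → Rt
  | app : Rt → List Rt → Rt
  | inl : Rt → Rt
  | inr : Rt → Rt
deriving Inhabited

/-- Rigid resource expressions: terms or (rigid) monomials. -/
abbrev REx : Type := Rt ⊕ List Rt

/-! ### Permutation expressions -/

/-- Permutation expressions: rigid expressions with a permutation attached to
each list of arguments. -/
inductive PE : Type
  | var : ℕ → PE
  | lam : PE → PE
  | inl : PE → PE
  | inr : PE → PE
  | app : PE → PE → PE
  | mon : (n : ℕ) → Equiv.Perm (Fin n) → List PE → PE

mutual
  /-- `Maps ε a a'` means that the permutation expression `ε` maps the rigid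
  term `a` to the rigid term `a'`, i.e. `ε : a ≅ a'`. -/
  inductive Maps : PE → Rt → Rt → Prop
    | var (x : ℕ) : Maps (.var x) (.var x) (.var x)
    | lam {α a a'} : Maps α a a' → Maps (.lam α) (.lam a) (.lam a')
    | inl {α a a'} : Maps α a a' → Maps (.inl α) (.inl a) (.inl a')
    | inr {α a a'} : Maps α a a' → Maps (.inr α) (.inr a) (.inr a')
    | app {γ δ : PE} {c c' : Rt} {ds ds' : List Rt} :
        Maps γ c c' → MapsM δ ds ds' → Maps (.app γ δ) (.app c ds) (.app c' ds')
  /-- `MapsM δ b⃗ b⃗'` means that the permutation monomial `δ = (σ,α₁,…,αₙ)`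
  maps the rigid monomial `b⃗` to `b⃗'`, with `αᵢ : bᵢ ≅ b'_{σ(i)}`. -/
  inductive MapsM : PE → List Rt → List Rt → Prop
    | mon {n : ℕ} (σ : Equiv.Perm (Fin n)) (αs : List PE) (as as' : List Rt)
        (hα : αs.length = n) (ha : as.length = n) (ha' : as'.length = n)
        (H : ∀ i : Fin n,
          Maps (αs.get (i.cast hα.symm)) (as.get (i.cast ha.symm))
            (as'.get ((σ i).cast ha'.symm))) :
        MapsM (.mon n σ αs) as as'
end

/-- `ε : r ≅ r'` at the level of rigid expressions. -/
def MapsE : PE → REx → REx → Prop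
  | ε, .inl a, .inl a' => Maps ε a a'
  | δ, .inr l, .inr l' => MapsM δ l l'
  | _, _, _ => False

/-! ### Isomorphism of rigid expressions, via permutation expressions -/

/-- Two rigid terms are isomorphic (`≅`) when some permutation expression maps
one to the other. -/
def IsoT (a a' : Rt) : Prop := ∃ ε : PE, Maps ε a a'

/-- Isomorphism of rigid monomials. -/
def IsoM (l l' : List Rt) : Prop := ∃ δ : PE, MapsM δ l l'

/-- Isomorphism of rigid expressions. -/
def IsoE (r r' : REx) : Prop := ∃ ε : PE, MapsE ε r r'

/-! ### Coherence -/

mutual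
  /-- Coherence on rigid resource terms. -/
  inductive CohT : Rt → Rt → Prop
    | var (x : ℕ) : CohT (.var x) (.var x)
    | lam {a a'} : CohT a a' → CohT (.lam a) (.lam a')
    | app {c c' : Rt} {ds ds' : List Rt} :
        CohT c c' → CohM ds ds' → CohT (.app c ds) (.app c' ds')
    | inl {a a'} : CohT a a' → CohT (.inl a) (.inl a')
    | inr {a a'} : CohT a a' → CohT (.inr a) (.inr a')
    | mix (a a' : Rt) : CohT (.inl a) (.inr a')
  /-- Coherence on rigid monomials: all elements pairwise coherent. -/
  inductive CohM : List Rt → List Rt → Prop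
    | mk {ds ds' : List Rt} (H : ∀ b ∈ ds ++ ds', ∀ b' ∈ ds ++ ds', CohT b b') :
        CohM ds ds'
end

/-- Coherence on rigid expressions. -/
def CohE : REx → REx → Prop
  | .inl a, .inl a' => CohT a a'
  | .inr l, .inr l' => CohM l l'
  | _, _ => False

/-! ### Occurrence counting and rigid substitution -/

namespace Rt

/-- Shift free de Bruijn indices `≥ c` up by one in a rigid term. -/
def shiftR (c : ℕ) : Rt → Rt
  | .var n => .var (if n < c then n else n + 1)
  | .lam a => .lam (a.shiftR (c + 1))
  | .inl a => .inl (a.shiftR c)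
  | .inr a => .inr (a.shiftR c)
  | .app d es => .app (d.shiftR c) (es.attach.map fun e => e.1.shiftR c)
termination_by r => sizeOf r
decreasing_by
  all_goals simp_wf
  all_goals try omega
  all_goals (have := List.sizeOf_lt_of_mem e.2; omega)

end Rt

/-- Number of free occurrences `n_x(a)` of the variable `x` in a rigid term. -/
def nx (x : ℕ) : Rt → ℕ
  | .var n => if n = x then 1 else 0
  | .lam a => nx (x + 1) a
  | .inl a => nx x a
  | .inr a => nx x a
  | .app d es => nx x d + (es.attach.map fun e => nx x e.1).sum
termination_by r => sizeOf r
decreasing_by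
  all_goals simp_wf
  all_goals try omega
  all_goals (have := List.sizeOf_lt_of_mem e.2; omega)

/-- Number of free occurrences of `x` in a rigid monomial. -/
def nxL (x : ℕ) (l : List Rt) : ℕ := (l.map (nx x)).sum

/-- Number of free occurrences of `x` in a rigid expression. -/
def nxE (x : ℕ) : REx → ℕ := Sum.elim (nx x) (nxL x)

mutual
  /-- Rigid substitution `r[b⃗/x]`: the occurrences of `x` in `r`, taken from
  left to right, are replaced by the successive elements of `b⃗`; it is
  undefined (`none`, i.e. the partial rigid expression `0`) unless `n_x(r) = |b⃗|`. -/
  def rsubst : Rt → ℕ → List Rt → Option Rt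
    | .var n, x, bs =>
        if n = x then (match bs with | [b] => some b | _ => none)
        else (match bs with
              | [] => some (.var (if x < n then n - 1 else n))
              | _ => none)
    | .lam a, x, bs => (rsubst a (x + 1) (bs.map (Rt.shiftR 0))).map .lam
    | .inl a, x, bs => (rsubst a x bs).map .inl
    | .inr a, x, bs => (rsubst a x bs).map .inr
    | .app c ds, x, bs =>
        match rsubst c x (bs.take (nx x c)), rsubstL ds x (bs.drop (nx x c)) with
        | some c', some ds' => some (.app c' ds')
        | _, _ => none
  /-- Rigid substitution in a rigid monomial. -/
  def rsubstL : List Rt → ℕ → List Rt → Option (List Rt)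
    | [], _, bs => (match bs with | [] => some [] | _ => none)
    | a :: as, x, bs =>
        match rsubst a x (bs.take (nx x a)), rsubstL as x (bs.drop (nx x a)) with
        | some a', some as' => some (a' :: as')
        | _, _ => none
end

/-- Rigid substitution on rigid expressions. -/
def rsubstE : REx → ℕ → List Rt → Option REx
  | .inl r, x, bs => (rsubst r x bs).map .inl
  | .inr l, x, bs => (rsubstL l x bs).map .inr

/-- Left action of a permutation on a list:
`σ·(b₁,…,bₙ) = (b_{σ⁻¹(1)},…,b_{σ⁻¹(n)})` (identity if the length is not `n`). -/
def permList {α : Type*} {n : ℕ} (σ : Equiv.Perm (Fin n)) (l : List α) : List α :=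
  if h : l.length = n then List.ofFn (fun j : Fin n => l.get ((σ.symm j).cast h.symm))
  else l



/-- Permutation expressions between two rigid terms. -/
abbrev Isos (a a' : Rt) : Type := {ε : PE // Maps ε a a'}

/-- Permutation expressions between two rigid monomials. -/
abbrev IsosM (l l' : List Rt) : Type := {δ : PE // MapsM δ l l'}

theorem Rt.induction {P : Rt → Prop} (var : ∀ n, P (.var n)) (lam : ∀ a, P a → P (.lam a))
    (inl : ∀ a, P a → P (.inl a)) (inr : ∀ a, P a → P (.inr a))
    (app : ∀ c ds, P c → (∀ i : Fin ds.length, P (ds.get i)) → P (.app c ds)) (a : Rt) : P a :=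
  Rt.rec (motive_1 := P) (motive_2 := fun l => ∀ d ∈ l, P d) var lam
    (fun c ds hc hds => app c ds hc fun i => hds _ (ds.get_mem i)) inl inr
    (by simp) (fun a l ha hl => by simpa using ⟨ha, hl⟩) a

namespace Isos

noncomputable def lamEquiv (a a' : Rt) : Isos (.lam a) (.lam a') ≃ Isos a a' :=
  Equiv.symm <| Equiv.ofBijective (fun α => ⟨.lam α.1, .lam α.2⟩)
    ⟨fun α β h => by simpa [Subtype.ext_iff] using h,
      fun ⟨ε, h⟩ => by cases h with | lam h => exact ⟨⟨_, h⟩, rfl⟩⟩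

noncomputable def inlEquiv (a a' : Rt) : Isos (.inl a) (.inl a') ≃ Isos a a' :=
  Equiv.symm <| Equiv.ofBijective (fun α => ⟨.inl α.1, .inl α.2⟩)
    ⟨fun α β h => by simpa [Subtype.ext_iff] using h,
      fun ⟨ε, h⟩ => by cases h with | inl h => exact ⟨⟨_, h⟩, rfl⟩⟩

noncomputable def inrEquiv (a a' : Rt) : Isos (.inr a) (.inr a') ≃ Isos a a' :=
  Equiv.symm <| Equiv.ofBijective (fun α => ⟨.inr α.1, .inr α.2⟩)
    ⟨fun α β h => by simpa [Subtype.ext_iff] using h,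
      fun ⟨ε, h⟩ => by cases h with | inr h => exact ⟨⟨_, h⟩, rfl⟩⟩

noncomputable def appEquiv (c c' : Rt) (ds ds' : List Rt) :
    Isos (.app c ds) (.app c' ds') ≃ Isos c c' × IsosM ds ds' :=
  Equiv.symm <| Equiv.ofBijective (fun α => ⟨.app α.1.1 α.2.1, .app α.1.2 α.2.2⟩)
    ⟨fun α β h => by simpa [Prod.ext_iff, Subtype.ext_iff] using h,
      fun ⟨ε, h⟩ => by cases h with | app h h' => exact ⟨⟨⟨_, h⟩, ⟨_, h'⟩⟩, rfl⟩⟩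

end Isos

def IsosM.toMon {n : ℕ} {a a' : Fin n → Rt}
    (p : Σ σ : Equiv.Perm (Fin n), ∀ i, Isos (a i) (a' (σ i))) :
    IsosM (List.ofFn a) (List.ofFn a') :=
  ⟨.mon n p.1 (List.ofFn fun i => (p.2 i).1), .mon p.1 _ _ _ (by simp) (by simp) (by simp)
    fun i => by simpa using (p.2 i).2⟩

theorem IsosM.toMon_bijective {n : ℕ} (a a' : Fin n → Rt) :
    Function.Bijective (IsosM.toMon (a := a) (a' := a')) := by
  constructor
  · rintro ⟨σ, p⟩ ⟨τ, q⟩ h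
    simp only [toMon, Subtype.mk.injEq, PE.mon.injEq, heq_eq_eq, true_and] at h
    obtain ⟨rfl, h⟩ := h
    have h := List.ofFn_injective h
    congr
    funext i
    exact Subtype.ext (congrFun h i)
  · rintro ⟨ε, h⟩
    suffices ∃ p : Σ σ : Equiv.Perm (Fin n), ∀ i, Isos (a i) (a' (σ i)), (toMon p).1 = ε from
      this.imp fun _ => Subtype.ext
    obtain ⟨l, hl⟩ : ∃ l, List.ofFn a = l := ⟨_, rfl⟩
    obtain ⟨l', hl'⟩ : ∃ l', List.ofFn a' = l' := ⟨_, rfl⟩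
    rw [hl, hl'] at h
    cases h with
    | mon σ αs _ _ hα ha ha' H =>
      subst hl
      rw [List.length_ofFn] at ha
      subst ha hl'
      refine ⟨⟨σ, fun i => ⟨αs.get (i.cast hα.symm), by simpa using H i⟩⟩, ?_⟩
      simp only [toMon, PE.mon.injEq, heq_eq_eq, true_and]
      refine List.ext_get (by simp [hα]) fun i _ _ => by simp

/-- An isomorphism of monomials is a bijection of positions together with isomorphisms
between corresponding elements. -/
theorem IsosM.nonempty_equiv {n n' : ℕ} (a : Fin n → Rt) (a' : Fin n' → Rt) :
    Nonempty (IsosM (List.ofFn a) (List.ofFn a') ≃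
      Σ σ : Fin n ≃ Fin n', ∀ i, Isos (a i) (a' (σ i))) := by
  by_cases h : n = n'
  · subst h
    exact ⟨(Equiv.ofBijective _ (toMon_bijective a a')).symm⟩
  · have : IsEmpty (Fin n ≃ Fin n') := ⟨fun e => h (by simpa using Fintype.card_congr e)⟩
    have : IsEmpty (IsosM (List.ofFn a) (List.ofFn a')) := ⟨fun ⟨ε, hε⟩ => h <| by
      generalize hl : List.ofFn a = l at hε
      generalize hl' : List.ofFn a' = l' at hε
      cases hε with
      | mon σ αs _ _ hα ha ha' H => rw [← hl, ← hl'] at *; simp_all⟩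
    exact ⟨Equiv.equivOfIsEmpty _ _⟩

theorem IsosM.nonempty_equiv_get (l l' : List Rt) :
    Nonempty (IsosM l l' ≃
      Σ σ : Fin l.length ≃ Fin l'.length, ∀ i, Isos (l.get i) (l'.get (σ i))) := by
  simpa using IsosM.nonempty_equiv l.get l'.get

theorem Isos.finite (a : Rt) : ∀ a', Finite (Isos a a') := by
  induction a using Rt.induction with
  | var n =>
    rintro a'
    refine Finite.of_injective (fun _ => ()) ?_
    rintro ⟨_, h⟩ ⟨_, h'⟩ -
    cases h; cases h'; rfl
  | lam a ih =>
    rintro (_ | a' | _ | _ | _)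
    case lam => have := ih a'; exact Finite.of_equiv _ (lamEquiv a a').symm
    all_goals exact @Finite.of_subsingleton _ ⟨fun ⟨_, h⟩ => nomatch h⟩
  | inl a ih =>
    rintro (_ | _ | _ | a' | _)
    case inl => have := ih a'; exact Finite.of_equiv _ (inlEquiv a a').symm
    all_goals exact @Finite.of_subsingleton _ ⟨fun ⟨_, h⟩ => nomatch h⟩
  | inr a ih =>
    rintro (_ | _ | _ | _ | a')
    case inr => have := ih a'; exact Finite.of_equiv _ (inrEquiv a a').symm
    all_goals exact @Finite.of_subsingleton _ ⟨fun ⟨_, h⟩ => nomatch h⟩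
  | app c ds ihc ihd =>
    rintro (_ | _ | ⟨c', ds'⟩ | _ | _)
    case app =>
      have := ihc c'
      have := fun i a' => ihd i a'
      obtain ⟨e⟩ := IsosM.nonempty_equiv_get ds ds'
      exact Finite.of_equiv _ ((appEquiv c c' ds ds').trans (.prodCongr (.refl _) e)).symm
    all_goals exact @Finite.of_subsingleton _ ⟨fun ⟨_, h⟩ => nomatch h⟩

theorem IsosM.finite (l l' : List Rt) : Finite (IsosM l l') := by
  have := fun a a' => Isos.finite a a'
  obtain ⟨e⟩ := IsosM.nonempty_equiv_get l l'
  exact Finite.of_equiv _ e.symm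

theorem Isos.nonempty_refl (a : Rt) : Nonempty (Isos a a) := by
  induction a using Rt.induction with
  | var n => exact ⟨⟨_, .var n⟩⟩
  | lam a ih => exact ih.map (lamEquiv a a).symm
  | inl a ih => exact ih.map (inlEquiv a a).symm
  | inr a ih => exact ih.map (inrEquiv a a).symm
  | app c ds ihc ihd =>
    obtain ⟨e⟩ := IsosM.nonempty_equiv_get ds ds
    exact ⟨(appEquiv c c ds ds).symm ⟨ihc.some, e.symm ⟨.refl _, fun i => (ihd i).some⟩⟩⟩

theorem IsosM.nonempty_refl (l : List Rt) : Nonempty (IsosM l l) := by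
  obtain ⟨e⟩ := IsosM.nonempty_equiv_get l l
  exact ⟨e.symm ⟨.refl _, fun i => (Isos.nonempty_refl _).some⟩⟩

/-- Bijections on the target positions transport families of isomorphisms. -/
theorem IsosM.nonempty_equiv_of_get {l' l'' : List Rt}
    (ρ : Fin l'.length ≃ Fin l''.length)
    (h : ∀ a i, Nonempty (Isos a (l'.get i) ≃ Isos a (l''.get (ρ i)))) (l : List Rt) :
    Nonempty (IsosM l l' ≃ IsosM l l'') := by
  obtain ⟨e⟩ := IsosM.nonempty_equiv_get l l'
  obtain ⟨e₂⟩ := IsosM.nonempty_equiv_get l l''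
  exact ⟨e.trans <| .trans (Equiv.sigmaCongr (Equiv.equivCongr (.refl _) ρ)
    fun σ => Equiv.piCongrRight fun i => (h _ (σ i)).some) e₂.symm⟩

/-- Isomorphic terms receive equally many isomorphisms from any term. -/
theorem Isos.nonempty_equiv_of_isos (a' : Rt) :
    ∀ a'', Isos a' a'' → ∀ a, Nonempty (Isos a a' ≃ Isos a a'') := by
  induction a' using Rt.induction with
  | var n => rintro _ ⟨_, h⟩ a; cases h; exact ⟨.refl _⟩
  | lam a' ih =>
    rintro (_ | a'' | _ | _ | _) φ
    case lam =>
      rintro (_ | a | _ | _ | _)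
      case lam =>
        exact (ih _ (lamEquiv _ _ φ) a).map fun e =>
          (lamEquiv _ _).trans (e.trans (lamEquiv _ _).symm)
      all_goals exact ⟨@Equiv.equivOfIsEmpty _ _ ⟨fun ⟨_, h⟩ => nomatch h⟩
        ⟨fun ⟨_, h⟩ => nomatch h⟩⟩
    all_goals (obtain ⟨_, h⟩ := φ; cases h)
  | inl a' ih =>
    rintro (_ | _ | _ | a'' | _) φ
    case inl =>
      rintro (_ | _ | _ | a | _)
      case inl =>
        exact (ih _ (inlEquiv _ _ φ) a).map fun e =>
          (inlEquiv _ _).trans (e.trans (inlEquiv _ _).symm)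
      all_goals exact ⟨@Equiv.equivOfIsEmpty _ _ ⟨fun ⟨_, h⟩ => nomatch h⟩
        ⟨fun ⟨_, h⟩ => nomatch h⟩⟩
    all_goals (obtain ⟨_, h⟩ := φ; cases h)
  | inr a' ih =>
    rintro (_ | _ | _ | _ | a'') φ
    case inr =>
      rintro (_ | _ | _ | _ | a)
      case inr =>
        exact (ih _ (inrEquiv _ _ φ) a).map fun e =>
          (inrEquiv _ _).trans (e.trans (inrEquiv _ _).symm)
      all_goals exact ⟨@Equiv.equivOfIsEmpty _ _ ⟨fun ⟨_, h⟩ => nomatch h⟩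
        ⟨fun ⟨_, h⟩ => nomatch h⟩⟩
    all_goals (obtain ⟨_, h⟩ := φ; cases h)
  | app c' ds' ihc ihd =>
    rintro (_ | _ | ⟨c'', ds''⟩ | _ | _) φ
    case app =>
      rintro (_ | _ | ⟨c, ds⟩ | _ | _)
      case app =>
        obtain ⟨φc, φd⟩ := appEquiv _ _ _ _ φ
        obtain ⟨e⟩ := IsosM.nonempty_equiv_get ds' ds''
        obtain ⟨e₁⟩ := ihc _ φc c
        obtain ⟨e₂⟩ := IsosM.nonempty_equiv_of_get (e φd).1
          (fun a i => ihd i _ ((e φd).2 i) a) ds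
        exact ⟨(appEquiv _ _ _ _).trans ((Equiv.prodCongr e₁ e₂).trans (appEquiv _ _ _ _).symm)⟩
      all_goals exact ⟨@Equiv.equivOfIsEmpty _ _ ⟨fun ⟨_, h⟩ => nomatch h⟩
        ⟨fun ⟨_, h⟩ => nomatch h⟩⟩
    all_goals (obtain ⟨_, h⟩ := φ; cases h)

theorem IsosM.nonempty_equiv_of_isosM {l' l'' : List Rt} (φ : IsosM l' l'') (l : List Rt) :
    Nonempty (IsosM l l' ≃ IsosM l l'') := by
  obtain ⟨e⟩ := IsosM.nonempty_equiv_get l' l''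
  exact IsosM.nonempty_equiv_of_get (e φ).1
    (fun a i => Isos.nonempty_equiv_of_isos _ _ ((e φ).2 i) a) l

namespace Isos

noncomputable def varEquiv (n m : ℕ) : Isos (.var n) (.var m) ≃ PLift (n = m) :=
  Equiv.symm <| Equiv.ofBijective (fun h => ⟨.var n, h.down ▸ .var n⟩)
    ⟨fun _ _ _ => Subsingleton.elim _ _,
      fun ⟨ε, h⟩ => by cases h with | var => exact ⟨⟨rfl⟩, rfl⟩⟩

end Isos

theorem IsosM.nonempty_equiv_map {f g : Rt → Rt} {l l' : List Rt}
    (h : ∀ i j, Nonempty (Isos (f (l.get i)) (f (l'.get j)) ≃ Isos (g (l.get i)) (g (l'.get j)))) :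
    Nonempty (IsosM (l.map f) (l'.map f) ≃ IsosM (l.map g) (l'.map g)) := by
  have key : ∀ (k : Rt → Rt) (l : List Rt), l.map k = List.ofFn fun i => k (l.get i) := by
    intro k l
    conv_lhs => rw [← List.ofFn_get l, List.map_ofFn]
    rfl
  rw [key f, key f, key g, key g]
  obtain ⟨e⟩ := IsosM.nonempty_equiv (fun i => f (l.get i)) (fun i => f (l'.get i))
  obtain ⟨e'⟩ := IsosM.nonempty_equiv (fun i => g (l.get i)) (fun i => g (l'.get i))
  exact ⟨e.trans <| (Equiv.sigmaCongrRight fun σ : Fin l.length ≃ Fin l'.length =>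
    Equiv.piCongrRight fun i => (h i (σ i)).some).trans e'.symm⟩

theorem Rt.shiftR_app (c : ℕ) (d : Rt) (es : List Rt) :
    (Rt.app d es).shiftR c = .app (d.shiftR c) (es.map (Rt.shiftR c)) := by
  rw [Rt.shiftR]; simp

theorem nx_app (x : ℕ) (d : Rt) (es : List Rt) : nx x (.app d es) = nx x d + nxL x es := by
  rw [nx, nxL]; simp

/-- Shifting preserves and reflects isomorphisms. -/
theorem Isos.nonempty_equiv_shiftR (a : Rt) :
    ∀ c a', Nonempty (Isos (a.shiftR c) (a'.shiftR c) ≃ Isos a a') := by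
  induction a using Rt.induction with
  | var n =>
    rintro c (m | _ | _ | _ | _)
    case var =>
      simp only [Rt.shiftR]
      exact ⟨(varEquiv _ _).trans <| .trans
        (Equiv.plift.trans <| (Equiv.ofIff (by split_ifs <;> omega)).trans Equiv.plift.symm)
        (varEquiv _ _).symm⟩
    all_goals
      simp only [Rt.shiftR_app, Rt.shiftR]
      exact ⟨@Equiv.equivOfIsEmpty _ _ ⟨fun ⟨_, h⟩ => nomatch h⟩ ⟨fun ⟨_, h⟩ => nomatch h⟩⟩
  | lam a ih =>
    rintro c (_ | a' | _ | _ | _)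
    case lam =>
      simp only [Rt.shiftR]
      exact (ih _ a').map fun e => (lamEquiv _ _).trans (e.trans (lamEquiv _ _).symm)
    all_goals
      simp only [Rt.shiftR_app, Rt.shiftR]
      exact ⟨@Equiv.equivOfIsEmpty _ _ ⟨fun ⟨_, h⟩ => nomatch h⟩ ⟨fun ⟨_, h⟩ => nomatch h⟩⟩
  | inl a ih =>
    rintro c (_ | _ | _ | a' | _)
    case inl =>
      simp only [Rt.shiftR]
      exact (ih _ a').map fun e => (inlEquiv _ _).trans (e.trans (inlEquiv _ _).symm)
    all_goals
      simp only [Rt.shiftR_app, Rt.shiftR]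
      exact ⟨@Equiv.equivOfIsEmpty _ _ ⟨fun ⟨_, h⟩ => nomatch h⟩ ⟨fun ⟨_, h⟩ => nomatch h⟩⟩
  | inr a ih =>
    rintro c (_ | _ | _ | _ | a')
    case inr =>
      simp only [Rt.shiftR]
      exact (ih _ a').map fun e => (inrEquiv _ _).trans (e.trans (inrEquiv _ _).symm)
    all_goals
      simp only [Rt.shiftR_app, Rt.shiftR]
      exact ⟨@Equiv.equivOfIsEmpty _ _ ⟨fun ⟨_, h⟩ => nomatch h⟩ ⟨fun ⟨_, h⟩ => nomatch h⟩⟩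
  | app b ds ihb ihd =>
    rintro c (_ | _ | ⟨b', ds'⟩ | _ | _)
    case app =>
      simp only [Rt.shiftR_app]
      obtain ⟨e₁⟩ := ihb c b'
      obtain ⟨e₂⟩ := IsosM.nonempty_equiv_map (f := Rt.shiftR c) (g := id) (l := ds) (l' := ds')
        fun i j => ihd i c (ds'.get j)
      rw [List.map_id, List.map_id] at e₂
      exact ⟨(appEquiv _ _ _ _).trans ((e₁.prodCongr e₂).trans (appEquiv _ _ _ _).symm)⟩
    all_goals
      simp only [Rt.shiftR_app, Rt.shiftR]
      exact ⟨@Equiv.equivOfIsEmpty _ _ ⟨fun ⟨_, h⟩ => nomatch h⟩ ⟨fun ⟨_, h⟩ => nomatch h⟩⟩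

mutual
  /-- Total rigid substitution: the `i`-th free occurrence of `x`, from left to right,
  is replaced by `f i`. -/
  def tsubst : Rt → ℕ → (ℕ → Rt) → Rt
    | .var n, x, f => if n = x then f 0 else .var (if x < n then n - 1 else n)
    | .lam a, x, f => .lam (tsubst a (x + 1) fun i => (f i).shiftR 0)
    | .inl a, x, f => .inl (tsubst a x f)
    | .inr a, x, f => .inr (tsubst a x f)
    | .app c ds, x, f => .app (tsubst c x f) (tsubstL ds x fun i => f (nx x c + i))
  /-- Total rigid substitution in a rigid monomial. -/
  def tsubstL : List Rt → ℕ → (ℕ → Rt) → List Rt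
    | [], _, _ => []
    | a :: as, x, f => tsubst a x f :: tsubstL as x fun i => f (nx x a + i)
end

/-- Total rigid substitution in a rigid expression. -/
def tsubstE (r : REx) (x : ℕ) (f : ℕ → Rt) : REx :=
  r.map (tsubst · x f) (tsubstL · x f)

theorem map_range_take (m n : ℕ) (f : ℕ → Rt) :
    ((List.range (m + n)).map f).take m = (List.range m).map f := by
  rw [List.range_add, List.map_append, List.take_left' (by simp)]

theorem map_range_drop (m n : ℕ) (f : ℕ → Rt) :
    ((List.range (m + n)).map f).drop m = (List.range n).map fun i => f (m + i) := by
  rw [List.range_add, List.map_append, List.drop_left' (by simp), List.map_map]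
  rfl

theorem rsubstL_map_range (x : ℕ) (ds : List Rt)
    (h : ∀ d ∈ ds, ∀ f, rsubst d x ((List.range (nx x d)).map f) = some (tsubst d x f)) :
    ∀ f, rsubstL ds x ((List.range (nxL x ds)).map f) = some (tsubstL ds x f) := by
  induction ds with
  | nil => intro f; simp [rsubstL, tsubstL, nxL]
  | cons d ds ih =>
    intro f
    have hn : nxL x (d :: ds) = nx x d + nxL x ds := by simp [nxL]
    rw [rsubstL, hn, map_range_take, map_range_drop, h d (by simp),
      ih fun e he => h e (by simp [he])]
    simp [tsubstL]

theorem rsubst_map_range (d : Rt) :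
    ∀ x f, rsubst d x ((List.range (nx x d)).map f) = some (tsubst d x f) := by
  induction d using Rt.induction with
  | var n =>
    intro x f
    by_cases h : n = x <;> simp [rsubst, tsubst, nx, h]
  | lam a ih =>
    intro x f
    rw [rsubst, nx, List.map_map, tsubst]
    exact congrArg _ (ih _ _)
  | inl a ih => intro x f; rw [rsubst, nx, ih, tsubst]; rfl
  | inr a ih => intro x f; rw [rsubst, nx, ih, tsubst]; rfl
  | app c ds ihc ihd =>
    intro x f
    rw [rsubst, nx_app, map_range_take, map_range_drop, ihc, rsubstL_map_range]
    · simp [tsubst]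
    · intro d hd f
      obtain ⟨i, rfl⟩ := List.get_of_mem hd
      exact ihd i x f

theorem rsubstE_map_range (r : REx) (x : ℕ) (f : ℕ → Rt) :
    rsubstE r x ((List.range (nxE x r)).map f) = some (tsubstE r x f) := by
  cases r with
  | inl d => simp [rsubstE, nxE, tsubstE, rsubst_map_range]
  | inr ds =>
    simp [rsubstE, nxE, tsubstE, rsubstL_map_range x ds fun d _ => rsubst_map_range d x]

theorem tsubstL_eq_ofFn (x : ℕ) (ds : List Rt) : ∀ f,
    tsubstL ds x f = List.ofFn fun i : Fin ds.length =>
      tsubst (ds.get i) x fun k => f (∑ j : Fin i, nx x (ds.get (Fin.castLE i.2.le j)) + k) := by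
  induction ds with
  | nil => intro f; simp [tsubstL]
  | cons d ds ih =>
    intro f
    rw [tsubstL, ih]
    simp only [List.length_cons, List.ofFn_succ]
    congr 1
    · congr 1
      funext k
      refine congrArg f (k.zero_add.symm.trans (congrArg (· + k) ?_))
      exact (Fin.sum_univ_zero _).symm
    · congr 1
      funext i
      have : ∑ j : Fin i.succ, nx x ((d :: ds).get (Fin.castLE i.succ.2.le j)) =
          nx x d + ∑ j : Fin i, nx x (ds.get (Fin.castLE i.2.le j)) := by
        exact Fin.sum_univ_succ (n := i) _
      rw [this]
      simp [add_assoc]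

theorem sum_nx_get (x : ℕ) (ds : List Rt) :
    ∑ i : Fin ds.length, nx x (ds.get i) = nxL x ds := by
  simp [nxL]

/-- A family of types `S f f'`, with `f` and `f'` sequences of rigid terms, is fibred over `A`
by occurrences when an element of `S f f'` amounts to an element `α` of `A`, which determines a
bijection between `n` and `m` positions, and isomorphisms between the terms at positions matched
by this bijection. -/
def FibredByOccurrences (A : Type) (n m : ℕ) (S : (ℕ → Rt) → (ℕ → Rt) → Type) : Prop :=
  ∃ P : A → (Fin n ≃ Fin m), ∀ f f',
    Nonempty (S f f' ≃ Σ α, ∀ i : Fin n, Isos (f i) (f' (P α i)))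

namespace FibredByOccurrences

theorem congr {A A' : Type} {n n' m m' : ℕ} {S S' : (ℕ → Rt) → (ℕ → Rt) → Type}
    (h : FibredByOccurrences A n m S) (eA : A ≃ A') (hn : n = n') (hm : m = m')
    (eS : ∀ f f', Nonempty (S f f' ≃ S' f f')) : FibredByOccurrences A' n' m' S' := by
  subst hn hm
  obtain ⟨P, hP⟩ := h
  refine ⟨fun α => P (eA.symm α), fun f f' => ?_⟩
  obtain ⟨e⟩ := hP f f'
  obtain ⟨e'⟩ := eS f f'
  exact ⟨e'.symm.trans (e.trans (Equiv.sigmaCongrLeft eA.symm).symm)⟩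

theorem of_isEmpty {A : Type} [IsEmpty A] {n m : ℕ} {S : (ℕ → Rt) → (ℕ → Rt) → Type}
    (h : ∀ f f', IsEmpty (S f f')) : FibredByOccurrences A n m S :=
  ⟨isEmptyElim, fun f f' => have := h f f'; ⟨Equiv.equivOfIsEmpty _ _⟩⟩

theorem shiftR {A : Type} {n m : ℕ} {S : (ℕ → Rt) → (ℕ → Rt) → Type}
    (h : FibredByOccurrences A n m S) (c : ℕ) :
    FibredByOccurrences A n m
      fun f f' => S (fun i => (f i).shiftR c) (fun i => (f' i).shiftR c) := by
  obtain ⟨P, hP⟩ := h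
  refine ⟨P, fun f f' => ?_⟩
  obtain ⟨e⟩ := hP (fun i => (f i).shiftR c) (fun i => (f' i).shiftR c)
  exact ⟨e.trans <| Equiv.sigmaCongrRight fun α => Equiv.piCongrRight fun i =>
    (Isos.nonempty_equiv_shiftR (f i) c (f' (P α i))).some⟩

theorem prod {A A' : Type} {n n' m m' : ℕ} {S S' : (ℕ → Rt) → (ℕ → Rt) → Type}
    (h : FibredByOccurrences A n m S) (h' : FibredByOccurrences A' n' m' S') :
    FibredByOccurrences (A × A') (n + n') (m + m')
      fun f f' => S f f' × S' (fun i => f (n + i)) (fun i => f' (m + i)) := by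
  obtain ⟨P, hP⟩ := h
  obtain ⟨P', hP'⟩ := h'
  refine ⟨fun α => finSumFinEquiv.symm.trans <|
    ((P α.1).sumCongr (P' α.2)).trans finSumFinEquiv, fun f f' => ?_⟩
  obtain ⟨e⟩ := hP f f'
  obtain ⟨e'⟩ := hP' (fun i => f (n + i)) (fun i => f' (m + i))
  refine ⟨(e.prodCongr e').trans <| Equiv.trans
    (β := Σ α : A × A', (∀ i : Fin n, Isos (f i) (f' (P α.1 i))) ×
      ∀ i : Fin n', Isos (f (n + i)) (f' (m + P' α.2 i)))
    ⟨fun p => ⟨(p.1.1, p.2.1), (p.1.2, p.2.2)⟩, fun p => (⟨p.1.1, p.2.1⟩, ⟨p.1.2, p.2.2⟩),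
      fun _ => rfl, fun _ => rfl⟩ <|
    Equiv.sigmaCongrRight fun α => .trans (Equiv.sumPiEquivProdPi
      (Sum.elim (fun i : Fin n => Isos (f i) (f' (P α.1 i)))
        fun i : Fin n' => Isos (f (n + i)) (f' (m + P' α.2 i)))).symm <|
    Equiv.piCongr finSumFinEquiv fun i => Equiv.cast ?_⟩
  rcases i with i | i <;> simp

theorem sigmaPi {k k' : ℕ} {n : Fin k → ℕ} {n' : Fin k' → ℕ} {A : Fin k → Fin k' → Type}
    {S : Fin k → Fin k' → (ℕ → Rt) → (ℕ → Rt) → Type}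
    (h : ∀ i j, FibredByOccurrences (A i j) (n i) (n' j) (S i j)) :
    FibredByOccurrences (Σ σ : Fin k ≃ Fin k', ∀ i, A i (σ i)) (∑ i, n i) (∑ j, n' j)
      fun f f' => Σ σ : Fin k ≃ Fin k', ∀ i, S i (σ i)
        (fun l => f (∑ j : Fin i, n (Fin.castLE i.2.le j) + l))
        (fun l => f' (∑ j : Fin (σ i), n' (Fin.castLE (σ i).2.le j) + l)) := by
  choose P hP using h
  refine ⟨fun α => finSigmaFinEquiv.symm.trans <|
    (Equiv.sigmaCongr α.1 fun i => P i (α.1 i) (α.2 i)).trans finSigmaFinEquiv, fun f f' => ?_⟩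
  have e i j := (hP i j (fun l => f (∑ j : Fin i, n (Fin.castLE i.2.le j) + l))
    (fun l => f' (∑ i : Fin j, n' (Fin.castLE j.2.le i) + l))).some
  let T (σ : Fin k ≃ Fin k') (α : ∀ i, A i (σ i)) (i : Fin k) (l : Fin (n i)) : Type :=
    Isos (f (∑ j : Fin i, n (Fin.castLE i.2.le j) + l))
      (f' (∑ j : Fin (σ i), n' (Fin.castLE (σ i).2.le j) + P i (σ i) (α i) l))
  refine ⟨(Equiv.sigmaCongrRight fun σ : Fin k ≃ Fin k' => Equiv.piCongrRight fun i => e i (σ i)).trans <| Equiv.trans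
    (β := Σ α : (Σ σ : Fin k ≃ Fin k', ∀ i, A i (σ i)), ∀ i l, T α.1 α.2 i l)
    ⟨fun p => ⟨⟨p.1, fun i => (p.2 i).1⟩, fun i => (p.2 i).2⟩,
      fun p => ⟨p.1.1, fun i => ⟨p.1.2 i, p.2 i⟩⟩, fun _ => rfl, fun _ => rfl⟩ <|
    Equiv.sigmaCongrRight fun α => .trans (Equiv.piCurry (T α.1 α.2)).symm <|
    Equiv.piCongr finSigmaFinEquiv fun p => Equiv.cast ?_⟩
  simp only [T, finSigmaFinEquiv_apply, Equiv.trans_apply, Equiv.symm_apply_apply]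
  rfl

end FibredByOccurrences

theorem fibredByOccurrences_tsubstL {x : ℕ} {ds ds' : List Rt}
    (h : ∀ i j, FibredByOccurrences (Isos (ds.get i) (ds'.get j)) (nx x (ds.get i))
      (nx x (ds'.get j)) fun f f' => Isos (tsubst (ds.get i) x f) (tsubst (ds'.get j) x f')) :
    FibredByOccurrences (IsosM ds ds') (nxL x ds) (nxL x ds')
      fun f f' => IsosM (tsubstL ds x f) (tsubstL ds' x f') := by
  refine (FibredByOccurrences.sigmaPi h).congr (IsosM.nonempty_equiv_get ds ds').some.symm
    (sum_nx_get x ds) (sum_nx_get x ds') fun f f' => ?_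
  rw [tsubstL_eq_ofFn, tsubstL_eq_ofFn]
  exact (IsosM.nonempty_equiv _ _).map Equiv.symm

/-- Isomorphisms between substitutions into coherent terms decompose uniquely. -/
theorem fibredByOccurrences_tsubst (d : Rt) : ∀ x d', CohT d d' →
    FibredByOccurrences (Isos d d') (nx x d) (nx x d')
      fun f f' => Isos (tsubst d x f) (tsubst d' x f') := by
  induction d using Rt.induction with
  | var n =>
    intro x d' h
    cases h
    let (m : ℕ) : Unique (Isos (.var m) (.var m)) :=
      @Equiv.unique _ _ ⟨⟨⟨rfl⟩⟩, fun _ => rfl⟩ (Isos.varEquiv m m)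
    refine ⟨fun _ => .refl _, fun f f' => ?_⟩
    by_cases hx : n = x
    · have hn : nx x (.var n) = 1 := by simp [nx, hx]
      simp only [tsubst, if_pos hx]
      rw [hn]
      exact ⟨(Equiv.uniqueSigma _ |>.trans <| Equiv.piUnique _).symm⟩
    · have hn : nx x (.var n) = 0 := by simp [nx, hx]
      simp only [tsubst, if_neg hx]
      rw [hn]
      exact ⟨(Equiv.ofUnique _ (Isos (.var n) (.var n))).trans (Equiv.sigmaUnique _ _).symm⟩
  | lam a ih =>
    rintro x _ (_ | h)
    refine ((ih (x + 1) _ h).shiftR 0).congr (Isos.lamEquiv _ _).symm (by rw [nx]) (by rw [nx])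
      fun f f' => ?_
    simp only [tsubst]
    exact ⟨(Isos.lamEquiv _ _).symm⟩
  | inl a ih =>
    rintro x _ (_ | _ | _ | h | _ | _)
    · refine (ih x _ h).congr (Isos.inlEquiv _ _).symm (by rw [nx]) (by rw [nx]) fun f f' => ?_
      simp only [tsubst]
      exact ⟨(Isos.inlEquiv _ _).symm⟩
    · have (a a' : Rt) : IsEmpty (Isos (.inl a) (.inr a')) := ⟨fun ⟨_, h⟩ => nomatch h⟩
      refine .of_isEmpty fun f f' => ?_
      simp only [tsubst]
      infer_instance
  | inr a ih =>
    rintro x _ (_ | _ | _ | _ | h)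
    refine (ih x _ h).congr (Isos.inrEquiv _ _).symm (by rw [nx]) (by rw [nx]) fun f f' => ?_
    simp only [tsubst]
    exact ⟨(Isos.inrEquiv _ _).symm⟩
  | app c ds ihc ihd =>
    rintro x _ (_ | _ | ⟨hc, ⟨hds⟩⟩)
    refine ((ihc x _ hc).prod (fibredByOccurrences_tsubstL fun i j => ihd i x _ <| hds _
      (List.mem_append_left _ (List.get_mem _ _)) _
      (List.mem_append_right _ (List.get_mem _ _)))).congr
      (Isos.appEquiv _ _ _ _).symm (by rw [nx_app]) (by rw [nx_app]) fun f f' => ?_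
    simp only [tsubst]
    exact ⟨(Isos.appEquiv _ _ _ _).symm⟩

/-- Permutation expressions between two rigid expressions. -/
abbrev IsosE (r r' : REx) : Type := {ε : PE // MapsE ε r r'}

theorem IsosE.finite : ∀ r r', Finite (IsosE r r')
  | .inl a, .inl a' => Isos.finite a a'
  | .inr l, .inr l' => IsosM.finite l l'
  | .inl _, .inr _ => @Finite.of_subsingleton _ ⟨fun ⟨_, h⟩ => h.elim⟩
  | .inr _, .inl _ => @Finite.of_subsingleton _ ⟨fun ⟨_, h⟩ => h.elim⟩

theorem IsosE.nonempty_refl : ∀ r, Nonempty (IsosE r r)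
  | .inl a => Isos.nonempty_refl a
  | .inr l => IsosM.nonempty_refl l

theorem IsosE.nonempty_equiv_of_isosE :
    ∀ {r r' : REx}, IsosE r r' → Nonempty (IsosE r r ≃ IsosE r r')
  | .inl a, .inl _, φ => Isos.nonempty_equiv_of_isos _ _ φ a
  | .inr l, .inr _, φ => IsosM.nonempty_equiv_of_isosM φ l
  | .inl _, .inr _, ⟨_, h⟩ => h.elim
  | .inr _, .inl _, ⟨_, h⟩ => h.elim

theorem fibredByOccurrences_tsubstE (x : ℕ) :
    ∀ r, CohE r r → FibredByOccurrences (IsosE r r) (nxE x r) (nxE x r)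
      fun f f' => IsosE (tsubstE r x f) (tsubstE r x f')
  | .inl d, h => fibredByOccurrences_tsubst d x d h
  | .inr _, ⟨h⟩ => fibredByOccurrences_tsubstL fun _ _ => fibredByOccurrences_tsubst _ x _ <|
      h _ (List.mem_append_left _ (List.get_mem _ _)) _
        (List.mem_append_left _ (List.get_mem _ _))

theorem map_range_getD (l : List Rt) : (List.range l.length).map (l.getD · default) = l :=
  List.ext_getElem (by simp) fun i _ h => by simp [h]

theorem length_permList {n : ℕ} (σ : Equiv.Perm (Fin n)) (l : List Rt) :
    (permList σ l).length = l.length := by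
  unfold permList
  split_ifs with h <;> simp [h]

theorem getD_permList {l : List Rt} (σ : Equiv.Perm (Fin l.length)) (i : Fin l.length) :
    (permList σ l).getD i default = l.get (σ.symm i) := by
  simp [permList]

theorem rsubstE_eq_tsubstE {x : ℕ} {r : REx} {l : List Rt} (h : l.length = nxE x r) :
    rsubstE r x l = some (tsubstE r x (l.getD · default)) := by
  conv_lhs => rw [← map_range_getD l, h]
  exact rsubstE_map_range r x _

/-- Isomorphisms from `r[b⃗/x]` to some `r[σ·b⃗/x]` amount to pairs of automorphisms
of `r` and `b⃗`. -/
theorem nonempty_sigma_isosE_equiv {x : ℕ} {r : REx} {bs : List Rt} (hcoh : CohE r r)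
    (hl : bs.length = nxE x r) :
    Nonempty ((Σ σ : Equiv.Perm (Fin bs.length), IsosE (tsubstE r x (bs.getD · default))
      (tsubstE r x ((permList σ bs).getD · default))) ≃ IsosE r r × IsosM bs bs) := by
  have h := fibredByOccurrences_tsubstE x r hcoh
  rw [← hl] at h
  obtain ⟨P, hP⟩ := h
  have e (σ : Equiv.Perm (Fin bs.length)) :=
    (hP (bs.getD · default) ((permList σ bs).getD · default)).some
  obtain ⟨e'⟩ := IsosM.nonempty_equiv_get bs bs
  let E (α : IsosE r r) : (Σ σ : Equiv.Perm (Fin bs.length), ∀ i : Fin bs.length,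
      Isos (bs.getD i default) ((permList σ bs).getD (P α i) default)) ≃
      Σ τ : Equiv.Perm (Fin bs.length), ∀ i, Isos (bs.get i) (bs.get (τ i)) :=
    Equiv.sigmaCongr ((Equiv.inv _).trans (Equiv.mulRight (P α))) fun σ =>
      Equiv.piCongrRight fun i => Equiv.cast <| by rw [getD_permList]; simp
  exact ⟨(Equiv.sigmaCongrRight e).trans <| Equiv.trans
    (β := Σ α : IsosE r r, Σ σ : Equiv.Perm (Fin bs.length), ∀ i : Fin bs.length,
      Isos (bs.getD i default) ((permList σ bs).getD (P α i) default))
    ⟨fun p => ⟨p.2.1, p.1, p.2.2⟩, fun p => ⟨p.2.1, p.1, p.2.2⟩, fun _ => rfl, fun _ => rfl⟩ <|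
    (Equiv.sigmaCongrRight E).trans <| (Equiv.sigmaEquivProd _ _).trans <|
    Equiv.prodCongr (.refl _) e'.symm⟩

/-! ### STATEMENT 16:
Let `r` be a uniform rigid resource expression (`r ¨ r`) and `b⃗` a rigid
monomial with `|b⃗| = n_x(r)`. Then
`Card(subSt_x(r,b⃗)) = Card(D(r)) · Card(D^!(b⃗)) / Card(D(r[b⃗/x]))`, where
`subSt_x(r,b⃗) = {σ ∈ S_{n_x(r)} | r[b⃗/x] ≅ r[σ·b⃗/x]}`. -/
theorem card_subst_stabilizer (x : ℕ) (r : REx) (bs : List Rt)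
    (hcoh : CohE r r) (hl : bs.length = nxE x r)
    (u : REx) (hu : rsubstE r x bs = some u) :
    (Nat.card {σ : Equiv.Perm (Fin bs.length) //
        ∃ u', rsubstE r x (permList σ bs) = some u' ∧ IsoE u u'} : ℚ) =
      (Nat.card {ε : PE // MapsE ε r r} * Nat.card {δ : PE // MapsM δ bs bs} : ℚ) /
        (Nat.card {ε : PE // MapsE ε u u} : ℚ) := by
  have hfin := IsosE.finite u u
  have hne := IsosE.nonempty_refl u
  have hpos : (Nat.card (IsosE u u) : ℚ) ≠ 0 := by exact_mod_cast Nat.card_pos.ne'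
  rw [eq_div_iff hpos]
  norm_cast
  rw [rsubstE_eq_tsubstE hl, Option.some.injEq] at hu
  obtain ⟨e⟩ := nonempty_sigma_isosE_equiv hcoh hl
  rw [hu] at e
  let v (σ : Equiv.Perm (Fin bs.length)) : REx :=
    tsubstE r x ((permList σ bs).getD · default)
  let Q (σ : Equiv.Perm (Fin bs.length)) : Prop := Nonempty (IsosE u (v σ))
  have hQ (σ : Equiv.Perm (Fin bs.length)) :
      (∃ u', rsubstE r x (permList σ bs) = some u' ∧ IsoE u u') ↔ Q σ := by
    rw [rsubstE_eq_tsubstE ((length_permList σ bs).trans hl)]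
    simp [Q, v, IsoE]
  rw [← Nat.card_prod, ← Nat.card_prod]
  refine Nat.card_congr (Equiv.trans ?_ e)
  exact .trans (.trans (Equiv.prodCongr (Equiv.subtypeEquivRight hQ) (.refl _))
    (Equiv.sigmaEquivProd _ _).symm) <|
    (Equiv.sigmaCongrRight fun σ : {σ // Q σ} =>
      (IsosE.nonempty_equiv_of_isosE σ.2.some).some).trans
    (Equiv.sigmaSubtypeEquivOfSubset (fun σ => IsosE u (v σ)) Q fun _ φ => ⟨φ⟩)
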